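/- Let d ≥ 2 and let w be a weight on S^{d-1} with w(S^{d-1}) = 1 and w(B) > 0 for every nonempty spherical cap B ⊂ S^{d-1}. Suppose r ∈ (0, π] and N is a positive integer such that w(B(x, r)) ≥ 1/N for all x ∈ S^{d-1}. Then there exists a constant C_w > 0, depending only on d (and on w only through its doubling-type behavior), and a partition of S^{d-1} into N pairwise disjoint measurable sets R_1, …, R_N such that w(R_j) = 1/N and diam(R_j) ≤ C_w · r (geodesic diameter) for every j = 1, …, N. -/

import Mathlib

open MeasureTheory Real Set
open scoped InnerProductSpace

noncomputable section

variable {d : ℕ}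

/-- The unit sphere `S^{d-1}` of `ℝ^d`. -/
def unitSphere (d : ℕ) : Set (EuclideanSpace ℝ (Fin d)) :=
  Metric.sphere (0 : EuclideanSpace ℝ (Fin d)) 1

/-- The geodesic distance `dist(x,y) = arccos (x ⬝ y)`. -/
def gdist (x y : EuclideanSpace ℝ (Fin d)) : ℝ := Real.arccos ⟪x, y⟫_ℝ

/-- The spherical cap with center `x` and radius `r`. -/
def cap (x : EuclideanSpace ℝ (Fin d)) (r : ℝ) : Set (EuclideanSpace ℝ (Fin d)) :=
  {y ∈ unitSphere d | gdist x y ≤ r}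

/-- The surface Lebesgue measure on the unit sphere, realized as the
`(d-1)`-dimensional Hausdorff measure restricted to the sphere. -/
def sphMeasure (d : ℕ) : Measure (EuclideanSpace ℝ (Fin d)) :=
  (Measure.hausdorffMeasure ((d : ℝ) - 1)).restrict (unitSphere d)

/-- `w(A) = ∫_A w dσ_d`. -/
def wMass (w : EuclideanSpace ℝ (Fin d) → ℝ) (A : Set (EuclideanSpace ℝ (Fin d))) : ℝ :=
  ∫ x in A, w x ∂(sphMeasure d)

/-- Evaluation of a `d`-variate real polynomial at a point of `ℝ^d`. -/
def pEval (P : MvPolynomial (Fin d) ℝ) (x : EuclideanSpace ℝ (Fin d)) : ℝ :=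
  MvPolynomial.eval (fun i => x i) P

/-- The geodesic arc joining `x` and `y`. -/
def arcSeg (x y : EuclideanSpace ℝ (Fin d)) : Set (EuclideanSpace ℝ (Fin d)) :=
  {z ∈ unitSphere d | ∃ t₁ t₂ : ℝ, 0 ≤ t₁ ∧ 0 ≤ t₂ ∧ z = t₁ • x + t₂ • y}

/-- Geodesic convexity of a subset of the sphere. -/
def GeoConvex (A : Set (EuclideanSpace ℝ (Fin d))) : Prop :=
  ∀ x ∈ A, ∀ y ∈ A, arcSeg x y ⊆ A

/-- The interior of a subset of the sphere relative to the sphere. -/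
def sphInterior (A : Set (EuclideanSpace ℝ (Fin d))) : Set (EuclideanSpace ℝ (Fin d)) :=
  {x ∈ A | ∃ ε : ℝ, 0 < ε ∧ Metric.ball x ε ∩ unitSphere d ⊆ A}

/-- The geodesic simplex spanned by `ξ 0, …, ξ (d-1)`. -/
def geodSimplex (ξ : Fin d → EuclideanSpace ℝ (Fin d)) :
    Set (EuclideanSpace ℝ (Fin d)) :=
  {z | ∃ t : Fin d → ℝ, (∀ j, 0 ≤ t j) ∧ (∑ j, t j) = 1 ∧
    z = ‖∑ j, t j • ξ j‖⁻¹ • ∑ j, t j • ξ j}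

/-- An admissible family `ξ 0, …, ξ (d-1)` of points of the sphere (the indices
`0, 1, …, d-1` correspond to `ξ_1, ξ_2, …, ξ_d` in the paper). -/
def Admissible (ξ : Fin d → EuclideanSpace ℝ (Fin d)) : Prop :=
  LinearIndependent ℝ ξ ∧ (∀ j, ξ j ∈ unitSphere d) ∧
  (∀ i j : Fin d, 1 ≤ (i : ℕ) → 1 ≤ (j : ℕ) → i ≠ j → ⟪ξ i, ξ j⟫_ℝ = 0) ∧
  (∀ i j : Fin d, (i : ℕ) = 0 → (j : ℕ) = 1 →
    Real.arccos ⟪ξ i, ξ j⟫_ℝ ∈ Set.Icc (π / 6) (π / 2)) ∧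
  (∀ i j : Fin d, (i : ℕ) = 0 → 2 ≤ (j : ℕ) → ⟪ξ i, ξ j⟫_ℝ = 0)

/-- A strongly `ε`-separated family of points of the sphere. -/
def StronglySep (ε : ℝ) (η : Fin d → EuclideanSpace ℝ (Fin d)) : Prop :=
  Function.Injective η ∧ (∀ j, η j ∈ unitSphere d) ∧
  ∀ j : Fin d, ∀ y ∈ Submodule.span ℝ (η '' {i | i ≠ j}), ε ≤ ‖η j - y‖

/-- The reflection negating the last coordinate. -/
def lastNeg (d : ℕ) (x : EuclideanSpace ℝ (Fin d)) : EuclideanSpace ℝ (Fin d) :=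
  (EuclideanSpace.equiv (Fin d) ℝ).symm fun i => if (i : ℕ) = d - 1 then -(x i) else x i

/-- The gradient of a `d`-variate polynomial, as a vector of `ℝ^d`. -/
def polyGrad (P : MvPolynomial (Fin d) ℝ) (x : EuclideanSpace ℝ (Fin d)) :
    EuclideanSpace ℝ (Fin d) :=
  (EuclideanSpace.equiv (Fin d) ℝ).symm fun i =>
    MvPolynomial.eval (fun j => x j) (MvPolynomial.pderiv i P)

/-- The tangential gradient `∇₀P(x) = ∇P(x) − (x⬝∇P(x))·x`. -/
def tGrad (P : MvPolynomial (Fin d) ℝ) (x : EuclideanSpace ℝ (Fin d)) :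
    EuclideanSpace ℝ (Fin d) :=
  polyGrad P x - ⟪x, polyGrad P x⟫_ℝ • x

/-- The affine hyperplane through the points `ξ j`. -/
def hplane (ξ : Fin d → EuclideanSpace ℝ (Fin d)) : Set (EuclideanSpace ℝ (Fin d)) :=
  (affineSpan ℝ (Set.range ξ) : Set (EuclideanSpace ℝ (Fin d)))

/-- The ball `B(x,r)_H = {y ∈ H : ‖x − y‖ ≤ r}` in a hyperplane `H`. -/
def ballH (H : Set (EuclideanSpace ℝ (Fin d))) (x : EuclideanSpace ℝ (Fin d)) (r : ℝ) :
    Set (EuclideanSpace ℝ (Fin d)) :=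
  {y ∈ H | ‖x - y‖ ≤ r}

/-- `w(A) = ∫_A w` with respect to `(d−1)`-dimensional Hausdorff (surface) measure. -/
def hMass (w : EuclideanSpace ℝ (Fin d) → ℝ) (A : Set (EuclideanSpace ℝ (Fin d))) : ℝ :=
  ∫ x in A, w x ∂(Measure.hausdorffMeasure ((d : ℝ) - 1))

/-- The interior of `A` relative to a hyperplane `H`. -/
def hInterior (H A : Set (EuclideanSpace ℝ (Fin d))) : Set (EuclideanSpace ℝ (Fin d)) :=
  {x ∈ A | ∃ ε : ℝ, 0 < ε ∧ Metric.ball x ε ∩ H ⊆ A}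

section EqualMass

open Metric Function

variable {X : Type*}

/-- In a nonatomic finite measure space, measurable sets have measurable subsets of every
smaller mass. -/
theorem exists_measurableSet_subset_measureReal_eq [MeasurableSpace X] [StandardBorelSpace X]
    (μ : Measure X) [IsFiniteMeasure μ] [NullSingletonClass μ] {A : Set X} (hA : MeasurableSet A)
    {c : ℝ} (hc : 0 ≤ c) (hcA : c ≤ μ.real A) :
    ∃ S ⊆ A, MeasurableSet S ∧ μ.real S = c := by
  set f : X → ℝ := fun x => (unitInterval.sigmoid (embeddingReal X x) : ℝ)
  have hf : MeasurableEmbedding f :=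
    (MeasurableEmbedding.subtype_coe measurableSet_Icc).comp
      (measurableEmbedding_sigmoid_comp_embeddingReal X)
  have hf01 (x : X) : f x ∈ Ioc (0 : ℝ) 1 :=
    ⟨Real.sigmoid_pos _, (unitInterval.sigmoid (embeddingReal X x)).2.2⟩
  set ν : Measure ℝ := (μ.restrict A).map f
  have hν : NullSingletonClass ν := ⟨fun t => by
    rw [Measure.map_apply hf.measurable (measurableSet_singleton t)]
    exact (subsingleton_singleton.preimage hf.injective).measure_zero _⟩
  have hg (t : ℝ) (ht : 0 ≤ t) :
      ∫ _ in (0 : ℝ)..t, (1 : ℝ) ∂ν = μ.real (f ⁻¹' Ioc 0 t ∩ A) := by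
    rw [intervalIntegral.integral_of_le ht, setIntegral_const, smul_eq_mul, mul_one,
      Measure.real, Measure.map_apply hf.measurable measurableSet_Ioc,
      Measure.restrict_apply (hf.measurable measurableSet_Ioc), Measure.real]
  have hcont : Continuous fun t : ℝ => ∫ _ in (0 : ℝ)..t, (1 : ℝ) ∂ν :=
    intervalIntegral.continuous_primitive (fun a b => intervalIntegrable_const) 0
  have hone : f ⁻¹' Ioc 0 1 ∩ A = A := inter_eq_right.2 fun x _ => hf01 x
  obtain ⟨t, ht, htc⟩ := intermediate_value_Icc zero_le_one hcont.continuousOn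
    (show c ∈ Icc _ _ by
      rw [intervalIntegral.integral_same, hg 1 zero_le_one, hone]
      exact ⟨hc, hcA⟩)
  exact ⟨f ⁻¹' Ioc 0 t ∩ A, inter_subset_right,
    (hf.measurable measurableSet_Ioc).inter hA, by rw [← hg t ht.1]; exact htc⟩

/-- `A` can be cut into finitely many measurable pieces of mass `m`, each contained in a ball of
radius `ρ`. -/
def HasEqualMassPartition [MeasurableSpace X] [PseudoMetricSpace X] (μ : Measure X) (m ρ : ℝ)
    (A : Set X) : Prop :=
  ∃ (κ : Type) (_ : Fintype κ) (R : κ → Set X), (∀ j, MeasurableSet (R j)) ∧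
    Pairwise (Disjoint on R) ∧ ⋃ j, R j = A ∧
    ∀ j, μ.real (R j) = m ∧ ∃ p, R j ⊆ closedBall p ρ

namespace HasEqualMassPartition

variable [MeasurableSpace X] [PseudoMetricSpace X] {μ : Measure X} {m ρ : ℝ} {A B : Set X}

theorem of_measureReal_eq (hA : MeasurableSet A) (hm : μ.real A = m)
    {p : X} (hp : A ⊆ closedBall p ρ) : HasEqualMassPartition μ m ρ A :=
  ⟨Unit, inferInstance, fun _ => A, fun _ => hA, Subsingleton.pairwise, iUnion_const A,
    fun _ => ⟨hm, p, hp⟩⟩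

theorem union (hA : HasEqualMassPartition μ m ρ A) (hB : HasEqualMassPartition μ m ρ B)
    (hAB : Disjoint A B) : HasEqualMassPartition μ m ρ (A ∪ B) := by
  obtain ⟨κ, _, R, hR, hRd, rfl, hRm⟩ := hA
  obtain ⟨κ', _, R', hR', hRd', rfl, hRm'⟩ := hB
  have hcross (i : κ) (j : κ') : Disjoint (R i) (R' j) :=
    hAB.mono (subset_iUnion R i) (subset_iUnion R' j)
  refine ⟨κ ⊕ κ', inferInstance, Sum.elim R R', ?_, ?_, ?_, ?_⟩
  · rintro (i | j)
    exacts [hR i, hR' j]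
  · rintro (i | i) (j | j) hij
    · exact hRd fun h => hij (congrArg _ h)
    · exact hcross i j
    · exact (hcross j i).symm
    · exact hRd' fun h => hij (congrArg _ h)
  · simp [iUnion_sum]
  · rintro (i | j)
    exacts [hRm i, hRm' j]

theorem of_measureReal_eq_nat_mul [StandardBorelSpace X] [IsFiniteMeasure μ]
    [NullSingletonClass μ] (hm : 0 ≤ m) {p : X} {k : ℕ} (hk : 1 ≤ k) (hA : MeasurableSet A)
    (hAm : μ.real A = k * m) (hp : A ⊆ closedBall p ρ) : HasEqualMassPartition μ m ρ A := by
  induction k, hk using Nat.le_induction generalizing A with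
  | base => exact of_measureReal_eq hA (by simpa using hAm) hp
  | succ k _ ih =>
    push_cast at hAm
    obtain ⟨S, hSA, hS, hSm⟩ := exists_measurableSet_subset_measureReal_eq μ hA hm
      (by rw [hAm]; nlinarith [(Nat.cast_nonneg k : (0 : ℝ) ≤ k)])
    rw [← union_sdiff_cancel hSA]
    refine (of_measureReal_eq hS hSm (hSA.trans hp)).union (ih (hA.diff hS) ?_
      (sdiff_subset.trans hp)) disjoint_sdiff_right
    rw [measureReal_sdiff hSA hS, hAm, hSm]
    ring

/-- Cells `C v` containing cores `K v` of mass at least `m`, indexed by a finite rooted tree of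
points, can be repartitioned into pieces of mass exactly `m` by passing remainders towards the
root. -/
theorem of_tree [StandardBorelSpace X] [IsFiniteMeasure μ]
    [NullSingletonClass μ] (hm : 0 < m) {r L : ℝ} (hρ : r + L ≤ ρ) {K : X → Set X} {f : X → ℕ}
    {b : X} (s : Finset X) (hb : b ∈ s)
    (hpar : ∀ v ∈ s, v ≠ b → ∃ u ∈ s, f u < f v ∧ dist u v ≤ L)
    (hK : ∀ v ∈ s, MeasurableSet (K v)) (hKm : ∀ v ∈ s, m ≤ μ.real (K v))
    (hKr : ∀ v ∈ s, K v ⊆ closedBall v r) (C : X → Set X)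
    (hC : ∀ v ∈ s, MeasurableSet (C v)) (hCd : (s : Set X).PairwiseDisjoint C)
    (hCρ : ∀ v ∈ s, C v ⊆ closedBall v ρ) (hKC : ∀ v ∈ s, K v ⊆ C v)
    (htot : ∃ k : ℤ, μ.real (⋃ v ∈ s, C v) = k * m) :
    HasEqualMassPartition μ m ρ (⋃ v ∈ s, C v) := by
  classical
  induction s using Finset.strongInduction generalizing C with
  | H s ih =>
  have hCm (v : X) (hv : v ∈ s) : m ≤ μ.real (C v) :=
    (hKm v hv).trans (measureReal_mono (hKC v hv))
  obtain hs | hs := (s.erase b).eq_empty_or_nonempty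
  · obtain rfl : s = {b} := by rw [← Finset.insert_erase hb, hs]; rfl
    simp only [Finset.mem_singleton, iUnion_iUnion_eq_left] at htot ⊢
    obtain ⟨k, hk⟩ := htot
    have hk0 : 0 < k := by
      have : (0 : ℝ) < k * m := hk ▸ hm.trans_le (hCm b hb)
      exact_mod_cast pos_of_mul_pos_left this hm.le
    lift k to ℕ using hk0.le
    exact of_measureReal_eq_nat_mul hm.le (by exact_mod_cast hk0) (hC b hb)
      (by exact_mod_cast hk) (hCρ b hb)
  · obtain ⟨v, hv, hvmax⟩ := (s.erase b).exists_max_image f hs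
    obtain ⟨hvb, hvs⟩ := Finset.mem_erase.1 hv
    obtain ⟨u, hus, huv, hdist⟩ := hpar v hvs hvb
    have huv' : u ≠ v := by rintro rfl; exact huv.false
    set q := ⌊μ.real (C v) / m⌋₊
    have hq1 : 1 ≤ q := Nat.le_floor (by rw [Nat.cast_one, one_le_div hm]; exact hCm v hvs)
    have hqle : q * m ≤ μ.real (C v) :=
      (le_div_iff₀ hm).1 (Nat.floor_le (div_nonneg measureReal_nonneg hm.le))
    have hqlt : μ.real (C v) < (q + 1) * m := (div_lt_iff₀ hm).1 (Nat.lt_floor_add_one _)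
    obtain ⟨S, hSK, hS, hSm⟩ := exists_measurableSet_subset_measureReal_eq μ (hK v hvs)
      (sub_nonneg.2 hqle) (by linarith [hKm v hvs])
    have hSC : S ⊆ C v := hSK.trans (hKC v hvs)
    set C' : X → Set X := update C u (C u ∪ S)
    have hC'u : C' u = C u ∪ S := update_self ..
    have hC' (x : X) (hx : x ≠ u) : C' x = C x := update_of_ne hx ..
    have hunion : ⋃ x ∈ s, C x = (⋃ x ∈ s.erase v, C' x) ∪ (C v \ S) := by
      ext y
      simp only [mem_iUnion, mem_union, mem_sdiff, Finset.mem_erase, exists_prop]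
      constructor
      · rintro ⟨x, hx, hy⟩
        obtain rfl | hxv := eq_or_ne x v
        · by_cases hyS : y ∈ S
          · exact Or.inl ⟨u, ⟨huv', hus⟩, hC'u ▸ Or.inr hyS⟩
          · exact Or.inr ⟨hy, hyS⟩
        · obtain rfl | hxu := eq_or_ne x u
          · exact Or.inl ⟨x, ⟨huv', hus⟩, hC'u ▸ Or.inl hy⟩
          · exact Or.inl ⟨x, ⟨hxv, hx⟩, hC' x hxu ▸ hy⟩
      · rintro (⟨x, ⟨hxv, hx⟩, hy⟩ | ⟨hy, -⟩)
        · obtain rfl | hxu := eq_or_ne x u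
          · rw [hC'u] at hy
            exact hy.elim (fun h => ⟨x, hx, h⟩) fun h => ⟨v, hvs, hSC h⟩
          · exact ⟨x, hx, hC' x hxu ▸ hy⟩
        · exact ⟨v, hvs, hy⟩
    have hdv (x : X) (hx : x ∈ s) (hxv : x ≠ v) : Disjoint (C x) (C v) := hCd hx hvs hxv
    have hdisj : Disjoint (⋃ x ∈ s.erase v, C' x) (C v \ S) := by
      simp only [disjoint_iUnion_left, Finset.mem_erase]
      rintro x ⟨hxv, hx⟩
      obtain rfl | hxu := eq_or_ne x u
      · rw [hC'u]
        exact ((hdv x hx hxv).mono_right sdiff_subset).union_left disjoint_sdiff_right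
      · rw [hC' x hxu]
        exact (hdv x hx hxv).mono_right sdiff_subset
    have hrest : μ.real (C v \ S) = q * m := by
      rw [measureReal_sdiff hSC hS, hSm]
      ring
    have hmono : s.erase v ⊆ s := s.erase_subset v
    rw [hunion]
    refine union (ih (s.erase v) (Finset.erase_ssubset hvs) ?_ ?_ ?_ ?_ ?_ C' ?_ ?_ ?_ ?_ ?_)
      (of_measureReal_eq_nat_mul hm.le hq1 ((hC v hvs).diff hS) hrest
        (sdiff_subset.trans (hCρ v hvs))) hdisj
    · exact Finset.mem_erase.2 ⟨hvb.symm, hb⟩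
    · intro x hx hxb
      obtain ⟨y, hys, hyx, hd⟩ := hpar x (hmono hx) hxb
      have hxv := hvmax x (Finset.mem_erase.2 ⟨hxb, hmono hx⟩)
      refine ⟨y, Finset.mem_erase.2 ⟨?_, hys⟩, hyx, hd⟩
      rintro rfl
      omega
    · exact fun x hx => hK x (hmono hx)
    · exact fun x hx => hKm x (hmono hx)
    · exact fun x hx => hKr x (hmono hx)
    · intro x hx
      obtain rfl | hxu := eq_or_ne x u
      · exact hC'u ▸ (hC x hus).union hS
      · exact hC' x hxu ▸ hC x (hmono hx)
    · have hu (x : X) (hx : x ∈ s) (hxv : x ≠ v) (hxu : x ≠ u) : Disjoint (C x) (C u ∪ S) :=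
        (hCd hx hus hxu).union_right ((hdv x hx hxv).mono_right hSC)
      intro x hx y hy hxy
      obtain ⟨hxv, hx⟩ := Finset.mem_erase.1 hx
      obtain ⟨hyv, hy⟩ := Finset.mem_erase.1 hy
      simp only [onFun]
      obtain rfl | hxu := eq_or_ne x u
      · rw [hC'u, hC' y hxy.symm]
        exact (hu y hy hyv hxy.symm).symm
      · obtain rfl | hyu := eq_or_ne y u
        · rw [hC'u, hC' x hxu]
          exact hu x hx hxv hxu
        · rw [hC' x hxu, hC' y hyu]
          exact hCd hx hy hxy
    · intro x hx
      obtain rfl | hxu := eq_or_ne x u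
      · rw [hC'u]
        refine union_subset (hCρ x hus) fun y hy => ?_
        have hyv : dist y v ≤ r := hKr v hvs (hSK hy)
        have := dist_triangle_right y x v
        rw [mem_closedBall]
        linarith
      · exact hC' x hxu ▸ hCρ x (hmono hx)
    · intro x hx
      obtain rfl | hxu := eq_or_ne x u
      · exact hC'u ▸ (hKC x hus).trans subset_union_left
      · exact hC' x hxu ▸ hKC x (hmono hx)
    · obtain ⟨k, hk⟩ := htot
      refine ⟨k - q, ?_⟩
      rw [hunion, measureReal_union hdisj ((hC v hvs).diff hS) (measure_ne_top _ _), hrest] at hk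
      push_cast
      linarith

end HasEqualMassPartition

/-- The net points of a connected set form a connected graph when points of overlapping balls are
joined, hence a rooted tree in which `f` is the depth. -/
theorem exists_depth_of_isPreconnected [PseudoMetricSpace X] {T : Set X} (hT : IsPreconnected T)
    {V : Finset X} (hVT : ↑V ⊆ T) {δ : ℝ} (hδ : 0 ≤ δ) (hcov : T ⊆ ⋃ v ∈ V, closedBall v δ)
    {b : X} (hb : b ∈ V) :
    ∃ f : X → ℕ, ∀ v ∈ V, v ≠ b → ∃ u ∈ V, f u < f v ∧ dist u v ≤ 2 * δ := by
  let G : SimpleGraph X :=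
    { Adj := fun u v => u ≠ v ∧ u ∈ V ∧ v ∈ V ∧ dist u v ≤ 2 * δ
      symm := ⟨fun u v h => ⟨h.1.symm, h.2.2.1, h.2.1, dist_comm u v ▸ h.2.2.2⟩⟩
      loopless := ⟨fun _ h => h.1 rfl⟩ }
  have hreach (v : X) (hv : v ∈ V) : G.Reachable v b := by
    by_contra hvb
    have hclosed (P : X → Prop) : IsClosed (⋃ u ∈ {u | u ∈ V ∧ P u}, closedBall u δ) :=
      (V.finite_toSet.subset fun _ h => h.1).isClosed_biUnion fun _ _ => isClosed_closedBall
    obtain ⟨x, -, hx, hx'⟩ := isPreconnected_closed_iff.1 hT _ _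
      (hclosed fun u => G.Reachable u b) (hclosed fun u => ¬G.Reachable u b)
      (fun x hx => by
        obtain ⟨u, hu, hxu⟩ := mem_iUnion₂.1 (hcov hx)
        by_cases h : G.Reachable u b
        · exact Or.inl (mem_biUnion (show u ∈ {u | u ∈ V ∧ G.Reachable u b} from ⟨hu, h⟩) hxu)
        · exact Or.inr (mem_biUnion (show u ∈ {u | u ∈ V ∧ ¬G.Reachable u b} from ⟨hu, h⟩) hxu))
      ⟨b, hVT hb, mem_biUnion (show b ∈ {u | u ∈ V ∧ G.Reachable u b} from ⟨hb, .rfl⟩)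
        (mem_closedBall_self hδ)⟩
      ⟨v, hVT hv, mem_biUnion (show v ∈ {u | u ∈ V ∧ ¬G.Reachable u b} from ⟨hv, hvb⟩)
        (mem_closedBall_self hδ)⟩
    obtain ⟨u, ⟨hu, hub⟩, hxu⟩ := mem_iUnion₂.1 hx
    obtain ⟨u', ⟨hu', hub'⟩, hxu'⟩ := mem_iUnion₂.1 hx'
    rw [mem_closedBall] at hxu hxu'
    have hne : u' ≠ u := by rintro rfl; exact hub' hub
    have hadj : G.Adj u' u := ⟨hne, hu', hu, by linarith [dist_triangle_left u' u x]⟩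
    exact hub' (hadj.reachable.trans hub)
  refine ⟨fun v => G.dist v b, fun v hv hvb => ?_⟩
  obtain ⟨p, hp⟩ := (hreach v hv).exists_walk_length_eq_dist
  cases p with
  | nil => exact absurd rfl hvb
  | @cons _ u _ h p =>
    refine ⟨u, h.2.2.1, ?_, dist_comm u v ▸ h.2.2.2⟩
    rw [SimpleGraph.Walk.length_cons] at hp
    have := SimpleGraph.dist_le p
    change G.dist u b < G.dist v b
    omega

/-- A finite family of measurable sets can be shrunk to a disjoint one with the same union. -/
theorem exists_pairwiseDisjoint_iUnion_eq {ι : Type*} [MeasurableSpace X] (s : Finset ι)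
    {D : ι → Set X} (hD : ∀ i ∈ s, MeasurableSet (D i)) :
    ∃ C : ι → Set X, (∀ i ∈ s, MeasurableSet (C i)) ∧ (s : Set ι).PairwiseDisjoint C ∧
      (∀ i ∈ s, C i ⊆ D i) ∧ (⋃ i ∈ s, C i = ⋃ i ∈ s, D i) ∧
      ∀ i ∈ s, ∀ x ∈ D i, (∀ j ∈ s, x ∈ D j → j = i) → x ∈ C i := by
  classical
  obtain ⟨e, he⟩ := countable_iff_exists_injOn.1 s.countable_toSet
  have hmem (i : ι) (x : X) :
      x ∈ D i \ ⋃ j ∈ s.filter (e · < e i), D j ↔ x ∈ D i ∧ ∀ j ∈ s, e j < e i → x ∉ D j := by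
    simp
  refine ⟨fun i => D i \ ⋃ j ∈ s.filter (e · < e i), D j, fun i hi => ?_, fun i hi j hj hij => ?_,
    fun i _ => sdiff_subset, ?_, fun i hi x hx hxi => ?_⟩
  · exact (hD i hi).diff (Finset.measurableSet_biUnion _ fun j hj =>
      hD j (Finset.mem_filter.1 hj).1)
  · refine disjoint_left.2 fun x hx hx' => ?_
    rw [hmem] at hx hx'
    rcases lt_trichotomy (e i) (e j) with h | h | h
    · exact hx'.2 i hi h hx.1
    · exact hij (he hi hj h)
    · exact hx.2 j hj h hx'.1
  · refine (iUnion₂_mono fun i _ => sdiff_subset).antisymm fun x hx => ?_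
    obtain ⟨i, hi, hxi⟩ := mem_iUnion₂.1 hx
    obtain ⟨j, hj, hmin⟩ := (s.filter (x ∈ D ·)).exists_min_image e
      ⟨i, Finset.mem_filter.2 ⟨hi, hxi⟩⟩
    rw [Finset.mem_filter] at hj
    refine mem_iUnion₂.2 ⟨j, hj.1, (hmem j x).2 ⟨hj.2, fun k hk hlt hxk => ?_⟩⟩
    exact hlt.not_ge (hmin k (Finset.mem_filter.2 ⟨hk, hxk⟩))
  · refine (hmem i x).2 ⟨hx, fun j hj hlt hxj => ?_⟩
    rw [hxi j hj hxj] at hlt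
    exact hlt.false

/-- A compact connected set all of whose `r`-balls have mass at least `m` can be cut into pieces
of mass exactly `m` and diameter comparable to `r`, provided its mass is a multiple of `m`. -/
theorem hasEqualMassPartition_of_isConnected [MetricSpace X] [MeasurableSpace X] [BorelSpace X]
    [StandardBorelSpace X] (μ : Measure X) [IsFiniteMeasure μ] [NullSingletonClass μ]
    {T : Set X} (hTc : IsCompact T) (hT : IsConnected T) {r m : ℝ} (hr : 0 < r) (hm : 0 < m)
    (hball : ∀ x ∈ T, m ≤ μ.real (closedBall x r ∩ T)) {N : ℕ} (htot : μ.real T = N * m) :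
    HasEqualMassPartition μ m (5 * r) T := by
  lift r to NNReal using hr.le
  have hr0 : r ≠ 0 := by rintro rfl; exact hr.false
  have hpack : packingNumber (2 * r) T ≠ ⊤ := by
    obtain ⟨F, -, hF, hFc⟩ := exists_finite_isCover_of_isCompact hr0 hTc
    exact ((packingNumber_two_mul_le_externalCoveringNumber r T).trans_lt
      (hFc.externalCoveringNumber_le_encard.trans_lt hF.encard_lt_top)).ne
  have hfin : (maximalSeparatedSet (2 * r) T).Finite :=
    encard_ne_top_iff.1 (encard_maximalSeparatedSet hpack ▸ hpack)
  obtain ⟨V, hV⟩ : ∃ V : Finset X, ↑V = maximalSeparatedSet (2 * r) T := hfin.exists_finset_coe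
  have hVT : ↑V ⊆ T := hV ▸ maximalSeparatedSet_subset
  have hcov : T ⊆ ⋃ v ∈ V, closedBall v (2 * r) := by
    have := (isCover_maximalSeparatedSet hpack).subset_iUnion_closedBall
    rw [← hV] at this
    exact_mod_cast this
  have hsep (u : X) (hu : u ∈ V) (v : X) (hv : v ∈ V) (huv : u ≠ v) : 2 * r < dist u v := by
    have h : IsSeparated _ (V : Set X) := hV ▸ isSeparated_maximalSeparatedSet
    have : ↑(2 * r) < edist u v := h hu hv huv
    rw [edist_nndist] at this
    exact_mod_cast this
  obtain ⟨x, hx⟩ := hT.nonempty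
  obtain ⟨b, hb, -⟩ := mem_iUnion₂.1 (hcov hx)
  obtain ⟨f, hf⟩ := exists_depth_of_isPreconnected hT.isPreconnected hVT
    (by positivity) hcov hb
  set K : X → Set X := fun v => closedBall v r ∩ T
  have hK (v : X) : MeasurableSet (K v) := isClosed_closedBall.measurableSet.inter
    hTc.isClosed.measurableSet
  have hKd (u : X) (hu : u ∈ V) (v : X) (hv : v ∈ V) (x : X) (hxu : x ∈ K u) (hxv : x ∈ K v) :
      u = v := by
    by_contra huv
    have h₁ : dist x u ≤ r := hxu.1
    have h₂ : dist x v ≤ r := hxv.1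
    linarith [hsep u hu v hv huv, dist_triangle_left u v x]
  classical
  set D : X → Set X := fun v => (closedBall v (2 * r) ∩ T) \ ⋃ u ∈ V.erase v, K u
  obtain ⟨C, hC, hCd, hCD, hCU, hCK⟩ := exists_pairwiseDisjoint_iUnion_eq V (D := D)
    fun v _ => (isClosed_closedBall.measurableSet.inter hTc.isClosed.measurableSet).diff
      (Finset.measurableSet_biUnion _ fun u _ => hK u)
  have hmemD (v x : X) : x ∈ D v ↔ dist x v ≤ 2 * r ∧ x ∈ T ∧ ∀ u ∈ V, u ≠ v → x ∉ K u := by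
    simp only [D, mem_sdiff, mem_inter_iff, mem_closedBall, mem_iUnion, Finset.mem_erase,
      exists_prop, not_exists, not_and, and_assoc]
    tauto
  have hKD (v : X) (hv : v ∈ V) (x : X) (hx : x ∈ K v) : x ∈ D v := by
    have : dist x v ≤ r := hx.1
    exact (hmemD v x).2 ⟨by linarith, hx.2, fun u hu huv hxu => huv (hKd u hu v hv x hxu hx)⟩
  have hunion : ⋃ v ∈ V, C v = T := by
    rw [hCU]
    refine (iUnion₂_subset fun v _ x hx => ((hmemD v x).1 hx).2.1).antisymm fun x hx => ?_
    by_cases h : ∃ v ∈ V, x ∈ K v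
    · obtain ⟨v, hv, hxv⟩ := h
      exact mem_iUnion₂.2 ⟨v, hv, hKD v hv x hxv⟩
    · push Not at h
      obtain ⟨v, hv, hxv⟩ := mem_iUnion₂.1 (hcov hx)
      exact mem_iUnion₂.2 ⟨v, hv, (hmemD v x).2 ⟨hxv, hx, fun u hu _ => h u hu⟩⟩
  rw [← hunion]
  refine HasEqualMassPartition.of_tree hm (r := r) (L := 2 * (2 * r)) (by linarith) V hb hf
    (fun v _ => hK v) (fun v hv => hball v (hVT hv)) (fun v _ => inter_subset_left) C hC hCd
    (fun v hv x hx => ?_) (fun v hv x hx => ?_) ⟨N, by rw [hunion, htot]; norm_cast⟩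
  · have := ((hmemD v x).1 (hCD v hv hx)).1
    rw [mem_closedBall]
    linarith
  · refine hCK v hv x (hKD v hv x hx) fun u hu hxu => ?_
    by_contra huv
    exact ((hmemD u x).1 hxu).2.2 v hv (Ne.symm huv) hx

/-- Cutting a set of mass `N * m` into pieces of mass `m` takes exactly `N` pieces. -/
theorem HasEqualMassPartition.exists_fin [PseudoMetricSpace X] [MeasurableSpace X]
    {μ : Measure X} [IsFiniteMeasure μ] {m ρ : ℝ} {A : Set X}
    (h : HasEqualMassPartition μ m ρ A) (hm : m ≠ 0) {N : ℕ} (hA : μ.real A = N * m) :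
    ∃ R : Fin N → Set X, (∀ j, MeasurableSet (R j)) ∧ Pairwise (Disjoint on R) ∧
      ⋃ j, R j = A ∧ ∀ j, μ.real (R j) = m ∧ ∃ p, R j ⊆ closedBall p ρ := by
  obtain ⟨κ, _, R, hR, hRd, hRA, hRm⟩ := h
  have hcard : Fintype.card κ = N := by
    rw [← hRA, measureReal_iUnion_fintype hRd hR] at hA
    simpa [hRm, hm] using hA
  let e : Fin N ≃ κ := (Fintype.equivFinOfCardEq hcard).symm
  exact ⟨R ∘ e, fun j => hR _, fun i j hij => hRd (e.injective.ne hij),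
    (e.surjective.iUnion_comp R).trans hRA, fun j => hRm _⟩

end EqualMass

theorem isClosed_unitSphere : IsClosed (unitSphere d) := Metric.isClosed_sphere

theorem gdist_eq_angle {x y : EuclideanSpace ℝ (Fin d)} (hx : x ∈ unitSphere d)
    (hy : y ∈ unitSphere d) : gdist x y = InnerProductGeometry.angle x y := by
  rw [unitSphere, mem_sphere_zero_iff_norm] at hx hy
  rw [gdist, InnerProductGeometry.angle, hx, hy, mul_one, div_one]

theorem dist_eq_two_mul_sin_gdist {x y : EuclideanSpace ℝ (Fin d)} (hx : x ∈ unitSphere d)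
    (hy : y ∈ unitSphere d) : dist x y = 2 * Real.sin (gdist x y / 2) := by
  have h0 : 0 ≤ gdist x y := Real.arccos_nonneg _
  have hπ : gdist x y ≤ π := Real.arccos_le_pi _
  have hsq : dist x y ^ 2 = (2 * Real.sin (gdist x y / 2)) ^ 2 := by
    rw [dist_eq_norm, @norm_sub_sq_real, mul_pow, Real.sin_sq_eq_half_sub,
      mul_div_cancel₀ _ two_ne_zero, gdist_eq_angle hx hy, InnerProductGeometry.cos_angle]
    rw [unitSphere, mem_sphere_zero_iff_norm] at hx hy
    rw [hx, hy]
    ring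
  exact (pow_left_inj₀ dist_nonneg
    (mul_nonneg zero_le_two (Real.sin_nonneg_of_nonneg_of_le_pi (by linarith) (by linarith)))
    two_ne_zero).1 hsq

theorem dist_le_gdist {x y : EuclideanSpace ℝ (Fin d)} (hx : x ∈ unitSphere d)
    (hy : y ∈ unitSphere d) : dist x y ≤ gdist x y := by
  rw [dist_eq_two_mul_sin_gdist hx hy]
  linarith [Real.sin_le (x := gdist x y / 2) (div_nonneg (Real.arccos_nonneg _) zero_le_two)]

theorem gdist_le_pi_div_two_mul_dist {x y : EuclideanSpace ℝ (Fin d)} (hx : x ∈ unitSphere d)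
    (hy : y ∈ unitSphere d) : gdist x y ≤ π / 2 * dist x y := by
  have h0 : 0 ≤ gdist x y := Real.arccos_nonneg _
  have hπ : gdist x y ≤ π := Real.arccos_le_pi _
  have h := Real.mul_le_sin (x := gdist x y / 2) (by linarith) (by linarith)
  rw [dist_eq_two_mul_sin_gdist hx hy]
  calc gdist x y = π * (2 / π * (gdist x y / 2)) := by field_simp
    _ ≤ π * Real.sin (gdist x y / 2) := by gcongr
    _ = _ := by ring

theorem cap_subset_closedBall {x : EuclideanSpace ℝ (Fin d)} (hx : x ∈ unitSphere d) (r : ℝ) :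
    cap x r ⊆ Metric.closedBall x r ∩ unitSphere d := fun y hy =>
  ⟨by rw [Metric.mem_closedBall']; exact (dist_le_gdist hx hy.1).trans hy.2, hy.1⟩

theorem measurableSet_cap (x : EuclideanSpace ℝ (Fin d)) (r : ℝ) : MeasurableSet (cap x r) := by
  have hg : Continuous (gdist x) := Real.continuous_arccos.comp (by fun_prop)
  exact isClosed_unitSphere.measurableSet.inter (isClosed_le hg continuous_const).measurableSet

theorem wMass_eq_measureReal {w : EuclideanSpace ℝ (Fin d) → ℝ} (hw : ∀ x, 0 ≤ w x)
    (hwi : Integrable w (sphMeasure d)) {A : Set (EuclideanSpace ℝ (Fin d))}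
    (hA : MeasurableSet A) :
    wMass w A = ((sphMeasure d).withDensity fun x => ENNReal.ofReal (w x)).real A := by
  rw [wMass, integral_eq_lintegral_of_nonneg_ae (.of_forall hw) hwi.1.restrict, Measure.real,
    withDensity_apply _ hA]

/-- Equal-mass partitions of the sphere into sets of small diameter. -/
theorem equal_mass_small_diameter_partition (d : ℕ) (hd : 2 ≤ d) :
    ∃ C : ℝ, 0 < C ∧
      ∀ w : EuclideanSpace ℝ (Fin d) → ℝ,
        (∀ x, 0 ≤ w x) →
        Integrable w (sphMeasure d) →
        wMass w (unitSphere d) = 1 →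
        (∀ x ∈ unitSphere d, ∀ ρ : ℝ, 0 < ρ → 0 < wMass w (cap x ρ)) →
        ∀ r : ℝ, 0 < r → r ≤ π →
        ∀ N : ℕ, 0 < N →
          (∀ x ∈ unitSphere d, 1 / (N : ℝ) ≤ wMass w (cap x r)) →
          ∃ R : Fin N → Set (EuclideanSpace ℝ (Fin d)),
            (∀ j, MeasurableSet (R j)) ∧
            (Pairwise fun i j => Disjoint (R i) (R j)) ∧
            (⋃ j, R j) = unitSphere d ∧
            ∀ j, wMass w (R j) = 1 / (N : ℝ) ∧
              ∀ x ∈ R j, ∀ y ∈ R j, gdist x y ≤ C * r := by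
  refine ⟨5 * π, by positivity, fun w hw hwi hw1 _ r hr _ N hN hcap => ?_⟩
  have hS : MeasurableSet (unitSphere d) := isClosed_unitSphere.measurableSet
  have : NullSingletonClass (sphMeasure d) := by
    have hd' : (0 : ℝ) < d - 1 := sub_pos.2 (by exact_mod_cast hd)
    have := Measure.nullSingletonClass_hausdorff (EuclideanSpace ℝ (Fin d)) hd'
    exact Measure.restrict.instNullSingletonClass _
  set μ := (sphMeasure d).withDensity fun x => ENNReal.ofReal (w x)
  have : IsFiniteMeasure μ := isFiniteMeasure_withDensity_ofReal hwi.2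
  have hN' : (N : ℝ) ≠ 0 := by exact_mod_cast hN.ne'
  have htot : μ.real (unitSphere d) = N * (1 / N) := by
    rw [← wMass_eq_measureReal hw hwi hS, hw1, mul_one_div_cancel hN']
  have hball (x) (hx : x ∈ unitSphere d) :
      1 / (N : ℝ) ≤ μ.real (Metric.closedBall x r ∩ unitSphere d) := by
    refine (hcap x hx).trans ?_
    rw [wMass_eq_measureReal hw hwi (measurableSet_cap x r)]
    exact measureReal_mono (cap_subset_closedBall hx r)
  have hconn : IsConnected (unitSphere d) := by
    refine isConnected_sphere ?_ 0 zero_le_one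
    rw [rank_eq_card_basis (EuclideanSpace.basisFun (Fin d) ℝ).toBasis, Fintype.card_fin]
    exact_mod_cast hd
  obtain ⟨R, hR, hRd, hRU, hRm⟩ := (hasEqualMassPartition_of_isConnected μ
    (isCompact_sphere 0 1) hconn hr (by positivity) hball htot).exists_fin (by positivity) htot
  refine ⟨R, hR, hRd, hRU, fun j => ⟨?_, fun x hx y hy => ?_⟩⟩
  · rw [wMass_eq_measureReal hw hwi (hR j)]
    exact (hRm j).1
  · obtain ⟨p, hp⟩ := (hRm j).2
    have hsub : R j ⊆ unitSphere d := (subset_iUnion R j).trans hRU.subset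
    have hdist : dist x y ≤ 10 * r := by
      linarith [dist_triangle_right x y p, Metric.mem_closedBall.1 (hp hx),
        Metric.mem_closedBall.1 (hp hy)]
    calc gdist x y ≤ π / 2 * dist x y := gdist_le_pi_div_two_mul_dist (hsub hx) (hsub hy)
      _ ≤ π / 2 * (10 * r) := by gcongr
      _ = 5 * π * r := by ring
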